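/- Let S₃ = ⟨d₁,d₂,d₃⟩ be a symmetric numerical semigroup minimally generated by three positive integers. Then h₂ = K₂/g₃³ satisfies the identity h₂ = (1/12)·(1 − v) with v = π₃/g₃²; equivalently, 12·K₂ = g₃³ − π₃·g₃. -/

import Mathlib

/-- A numerical semigroup: a subset of ℕ containing 0, closed under addition,
with finite complement (the set of gaps). -/
def IsNumericalSemigroup (S : Set ℕ) : Prop :=
  0 ∈ S ∧ (∀ a ∈ S, ∀ b ∈ S, a + b ∈ S) ∧ (Sᶜ : Set ℕ).Finite

/-- The genus: the number of gaps of `S`. -/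
noncomputable def genus (S : Set ℕ) : ℕ := (Sᶜ : Set ℕ).ncard

/-- The Frobenius number: the largest gap of `S`. -/
noncomputable def frobeniusNum (S : Set ℕ) : ℕ := sSup (Sᶜ : Set ℕ)

/-- The conductorNum: the least `c` such that every `n ≥ c` belongs to `S`
(equal to `frobeniusNum S + 1` when `S ≠ ℕ`). -/
noncomputable def conductorNum (S : Set ℕ) : ℕ := sInf {c : ℕ | ∀ n : ℕ, c ≤ n → n ∈ S}

/-- `S` is symmetric: for every `n` with `0 ≤ n ≤ F` (where `F = conductorNum S - 1` is the
Frobenius number), `n` is a gap iff `F - n ∈ S`. -/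
def IsSymmetric (S : Set ℕ) : Prop :=
  ∀ n : ℕ, n < conductorNum S → (n ∉ S ↔ conductorNum S - 1 - n ∈ S)

/-- The submonoid of ℕ generated by two elements. -/
def gen2 (x y : ℕ) : Set ℕ := {n : ℕ | ∃ a b : ℕ, n = a * x + b * y}

/-- The numerical semigroup `⟨d₁, d₂, d₃⟩` generated by three elements. -/
def gen3 (d₁ d₂ d₃ : ℕ) : Set ℕ := {n : ℕ | ∃ a b c : ℕ, n = a * d₁ + b * d₂ + c * d₃}

/-- `⟨d₁, d₂, d₃⟩` is minimally generated by the three positive integers `d₁ < d₂ < d₃`: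
`gcd(d₁,d₂,d₃) = 1`, `3 ≤ d₁`, `d₃ ≤ d₁d₂ - d₁ - d₂`, and no generator lies in the
submonoid generated by the other two. -/
def MinGen3 (d₁ d₂ d₃ : ℕ) : Prop :=
  3 ≤ d₁ ∧ d₁ < d₂ ∧ d₂ < d₃ ∧ d₃ + d₁ + d₂ ≤ d₁ * d₂ ∧
    Nat.gcd d₁ (Nat.gcd d₂ d₃) = 1 ∧
    d₁ ∉ gen2 d₂ d₃ ∧ d₂ ∉ gen2 d₁ d₃ ∧ d₃ ∉ gen2 d₁ d₂

/-- The `r`-th gap power sum (higher genus) `G_r = Σ_{s gap} s^r`. -/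
noncomputable def gapPowerSum (S : Set ℕ) (r : ℕ) : ℕ := ∑ᶠ s ∈ (Sᶜ : Set ℕ), s ^ r

lemma exists_gen2_rep_lt {a b p q w : ℕ} (hp : 0 < p) (hpq : p * a = q * b)
    (hw : w ∈ gen2 a b) : ∃ x y, x < p ∧ w = x * a + y * b := by
  obtain ⟨x, y, rfl⟩ := hw
  refine ⟨x % p, y + x / p * q, Nat.mod_lt _ hp, ?_⟩
  conv_lhs => rw [← Nat.mod_add_div x p]
  linear_combination (x / p) * hpq

lemma gen2_rep_unique {a b p q x y x' y' : ℕ} (hb : 0 < b) (hpq : p * a = q * b)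
    (hco : Nat.Coprime p q) (hx : x < p) (hx' : x' < p)
    (h : x * a + y * b = x' * a + y' * b) : x = x' ∧ y = y' := by
  have hdvd : (p : ℤ) ∣ ((x : ℤ) - x') * q := by
    refine ⟨y' - y, ?_⟩
    have hb' : (b : ℤ) ≠ 0 := by exact_mod_cast hb.ne'
    apply mul_right_cancel₀ hb'
    zify at h hpq
    linear_combination (-((x : ℤ) - x')) * hpq + (p : ℤ) * h
  have hdvd' : (p : ℤ) ∣ (x : ℤ) - x' :=
    IsCoprime.dvd_of_dvd_mul_right (Nat.isCoprime_iff_coprime.mpr hco) hdvd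
  have hxx : x = x' := by
    have := Int.eq_zero_of_abs_lt_dvd hdvd' (by rw [abs_lt]; constructor <;> omega)
    omega
  subst hxx
  exact ⟨rfl, Nat.eq_of_mul_eq_mul_right hb (by omega)⟩

/-- The elements of `⟨a, b⟩` dividing `M` inside `⟨a, b⟩` form a complete-intersection pattern:
summing a mixed difference over them leaves only four corner terms. -/
lemma exists_corners_sum_mixed_diff {a b M : ℕ} (ha : 0 < a) (hb : 0 < b) (hM : M ∈ gen2 a b) :
    ∃ e₁ e₂ : ℕ, e₁ + e₂ = M + a + b ∧ ∀ A : Finset ℕ,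
      (∀ w, w ∈ A ↔ w ∈ gen2 a b ∧ ∃ w' ∈ gen2 a b, w + w' = M) → ∀ f : ℕ → ℝ,
      ∑ w ∈ A, (f (w + a + b) - f (w + a) - f (w + b) + f w)
        = f 0 - f e₁ - f e₂ + f (e₁ + e₂) := by
  obtain ⟨p, q, hp, hpq, hco⟩ : ∃ p q : ℕ, 0 < p ∧ p * a = q * b ∧ Nat.Coprime p q := by
    refine ⟨b / Nat.gcd a b, a / Nat.gcd a b,
      Nat.div_pos (Nat.gcd_le_right _ hb) (Nat.gcd_pos_of_pos_left _ ha), ?_,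
      (Nat.coprime_div_gcd_div_gcd (Nat.gcd_pos_of_pos_left _ ha)).symm⟩
    rw [Nat.div_mul_right_comm (Nat.gcd_dvd_right a b),
      Nat.div_mul_right_comm (Nat.gcd_dvd_left a b), mul_comm]
  obtain ⟨B, C, hB, hMrep⟩ := exists_gen2_rep_lt hp hpq hM
  let height : ℕ → ℕ := fun x => if x ≤ B then C + 1 else C + 1 - q
  obtain ⟨k, hk⟩ : ∃ k, p = B + 1 + k := ⟨p - (B + 1), by omega⟩
  have key : ∀ A : Finset ℕ,
      (∀ w, w ∈ A ↔ w ∈ gen2 a b ∧ ∃ w' ∈ gen2 a b, w + w' = M) → ∀ f : ℕ → ℝ,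
      ∑ w ∈ A, (f (w + a + b) - f (w + a) - f (w + b) + f w)
        = (f ((B + 1) * a + (C + 1) * b) - f ((B + 1) * a) - f ((C + 1) * b) + f 0)
          + (f (p * a + (C + 1 - q) * b) - f (p * a)
            - f ((B + 1) * a + (C + 1 - q) * b) + f ((B + 1) * a)) := by
    intro A hA f
    have hAimg : A = ((Finset.range p).sigma fun x => Finset.range (height x)).image
        (fun z => z.1 * a + z.2 * b) := by
      ext w
      simp only [hA, Finset.mem_image, Finset.mem_sigma, Finset.mem_range, height]
      constructor
      · rintro ⟨hw, w', hw', hsum⟩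
        obtain ⟨x, y, hx, rfl⟩ := exists_gen2_rep_lt hp hpq hw
        obtain ⟨x', y', hx', rfl⟩ := exists_gen2_rep_lt hp hpq hw'
        refine ⟨⟨x, y⟩, ⟨hx, ?_⟩, rfl⟩
        rcases lt_or_ge (x + x') p with hlt | hge
        · have := gen2_rep_unique (x := x + x') (y := y + y') hb hpq hco hlt hB
            (by rw [← hMrep, ← hsum]; ring)
          dsimp only
          split_ifs <;> omega
        · have := gen2_rep_unique (x := x + x' - p) (y := y + y' + q) hb hpq hco (by omega) hB
            (by
              rw [← hMrep, ← hsum]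
              zify [hge] at hpq ⊢
              linear_combination -hpq)
          dsimp only
          split_ifs <;> omega
      · rintro ⟨⟨x, y⟩, ⟨hx, hy⟩, rfl⟩
        dsimp only at hx hy ⊢
        refine ⟨⟨x, y, rfl⟩, ?_⟩
        split_ifs at hy with hxB
        · refine ⟨(B - x) * a + (C - y) * b, ⟨_, _, rfl⟩, ?_⟩
          have hyC : y ≤ C := by omega
          rw [hMrep]
          zify [hxB, hyC]
          ring
        · refine ⟨(B + p - x) * a + (C - (y + q)) * b, ⟨_, _, rfl⟩, ?_⟩
          have hyC : y + q ≤ C := by omega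
          have hxp : x ≤ B + p := by omega
          rw [hMrep]
          zify [hxp, hyC] at hpq ⊢
          linear_combination hpq
    have hinj : Set.InjOn (fun z : (_ : ℕ) × ℕ => z.1 * a + z.2 * b)
        ((Finset.range p).sigma fun x => Finset.range (height x)) := by
      rintro ⟨x, y⟩ hz ⟨x', y'⟩ hz' heq
      simp only [Finset.coe_sigma, Set.mem_sigma_iff, Finset.mem_coe, Finset.mem_range]
        at hz hz'
      obtain ⟨rfl, rfl⟩ := gen2_rep_unique hb hpq hco hz.1 hz'.1 heq
      rfl
    have hcol : ∀ x h : ℕ, ∑ y ∈ Finset.range h,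
        (f (x * a + y * b + a + b) - f (x * a + y * b + a) - f (x * a + y * b + b)
          + f (x * a + y * b))
        = (f ((x + 1) * a + h * b) - f ((x + 1) * a)) - (f (x * a + h * b) - f (x * a)) := by
      intro x h
      induction h with
      | zero => simp
      | succ h ih =>
        rw [Finset.sum_range_succ, ih, show x * a + h * b + a + b = (x + 1) * a + (h + 1) * b by ring,
          show x * a + h * b + a = (x + 1) * a + h * b by ring,
          show x * a + h * b + b = x * a + (h + 1) * b by ring]
        ring
    have hlow : ∀ x ∈ Finset.range (B + 1), height x = C + 1 := by
      intro x hx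
      have := Finset.mem_range.mp hx
      exact if_pos (by omega)
    have hhigh : ∀ x, height (B + 1 + x) = C + 1 - q := fun x => if_neg (by omega)
    rw [hAimg, Finset.sum_image hinj, Finset.sum_sigma]
    simp only [hcol]
    rw [hk, Finset.sum_range_add]
    congr 1
    · rw [Finset.sum_congr rfl fun x hx => by rw [hlow x hx],
        Finset.sum_range_sub fun x => f (x * a + (C + 1) * b) - f (x * a)]
      simp only [zero_mul, zero_add]
      ring
    · simp only [hhigh]
      have := Finset.sum_range_sub
        (fun x => f ((B + 1 + x) * a + (C + 1 - q) * b) - f ((B + 1 + x) * a)) k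
      simp only [← add_assoc, add_zero] at this
      rw [this]
      ring
  rcases lt_or_ge C q with hCq | hCq
  · refine ⟨(B + 1) * a, (C + 1) * b, by rw [hMrep]; ring, fun A hA f => ?_⟩
    rw [key A hA f, Nat.sub_eq_zero_of_le hCq]
    simp only [zero_mul, add_zero]
    ring
  · have hle : q ≤ C + 1 := by omega
    have htop : p * a + ((B + 1) * a + (C + 1 - q) * b) = (B + 1) * a + (C + 1) * b := by
      zify [hle] at hpq ⊢
      linear_combination hpq
    refine ⟨p * a, (B + 1) * a + (C + 1 - q) * b, by rw [htop, hMrep]; ring, fun A hA f => ?_⟩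
    have hcorner : p * a + (C + 1 - q) * b = (C + 1) * b := by
      zify [hle] at hpq ⊢
      linear_combination hpq
    rw [key A hA f, htop, hcorner]
    ring

/-- Telescoping along residue classes modulo `d`: `A` is the Apéry set of the complement of `Γ`. -/
lemma sum_apery_add_sum_gaps {d : ℕ} {A Γ : Finset ℕ}
    (hΓ : ∀ m, m + d ∈ Γ → m ∈ Γ)
    (hA : ∀ m, m ∈ A ↔ m ∉ Γ ∧ (d ≤ m → m - d ∈ Γ)) (f : ℕ → ℝ) :
    ∑ w ∈ A, f w + ∑ s ∈ Γ, f s = ∑ r ∈ Finset.range d, f r + ∑ s ∈ Γ, f (s + d) := by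
  have hAΓ : Disjoint A Γ := Finset.disjoint_left.mpr fun m hm => ((hA m).mp hm).1
  have hd : Disjoint (Finset.range d) (Γ.image (· + d)) := by
    refine Finset.disjoint_left.mpr fun m hm hm' => ?_
    obtain ⟨s, -, rfl⟩ := Finset.mem_image.mp hm'
    have := Finset.mem_range.mp hm
    omega
  have hU : A ∪ Γ = Finset.range d ∪ Γ.image (· + d) := by
    ext m
    simp only [Finset.mem_union, hA, Finset.mem_range, Finset.mem_image]
    rcases lt_or_ge m d with hm | hm
    · simp only [hm, true_or, iff_true]
      by_cases h : m ∈ Γ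
      · exact Or.inr h
      · exact Or.inl ⟨h, fun h' => by omega⟩
    · obtain ⟨n, rfl⟩ := Nat.exists_eq_add_of_le' hm
      simp only [Nat.add_sub_cancel, add_left_inj, exists_eq_right, hm, true_imp_iff]
      constructor
      · rintro (h | h)
        exacts [Or.inr h.2, Or.inr (hΓ n h)]
      · intro h
        by_cases h' : n + d ∈ Γ
        exacts [Or.inr h', Or.inl ⟨h', h.resolve_left (by omega)⟩]
  rw [← Finset.sum_union hAΓ, hU, Finset.sum_union hd,
    Finset.sum_image fun x _ y _ h => Nat.add_right_cancel h]

lemma sum_range_mixed_diff_sq (d : ℕ) (a b : ℝ) :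
    ∑ r ∈ Finset.range d, ((r + a + b) ^ 2 - (r + a) ^ 2 - (r + b) ^ 2 + (r : ℝ) ^ 2)
      = 2 * d * a * b := by
  induction d with
  | zero => simp
  | succ d ih => rw [Finset.sum_range_succ, ih]; push_cast; ring

lemma sum_range_mixed_diff_pow_five (d : ℕ) (a b : ℝ) :
    ∑ r ∈ Finset.range d, ((r + a + b) ^ 5 - (r + a) ^ 5 - (r + b) ^ 5 + (r : ℝ) ^ 5)
      = 60 * (d * a * b) * ((d + a + b - 1) / 2 * (((d + a + b - 1) / 2) ^ 2
        + (d ^ 2 + a ^ 2 + b ^ 2 - 1) / 4) / 3) := by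
  induction d with
  | zero => simp
  | succ d ih => rw [Finset.sum_range_succ, ih]; push_cast; ring

lemma gen3_add_mem {d₁ d₂ d₃ m n : ℕ} (hm : m ∈ gen3 d₁ d₂ d₃) (hn : n ∈ gen3 d₁ d₂ d₃) :
    m + n ∈ gen3 d₁ d₂ d₃ := by
  obtain ⟨a, b, c, rfl⟩ := hm
  obtain ⟨a', b', c', rfl⟩ := hn
  exact ⟨a + a', b + b', c + c', by ring⟩

lemma gen2_subset_gen3 {d₁ d₂ d₃ : ℕ} : gen2 d₂ d₃ ⊆ gen3 d₁ d₂ d₃ := by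
  rintro _ ⟨b, c, rfl⟩
  exact ⟨0, b, c, by ring⟩

lemma generator_mem_gen3 (d₁ d₂ d₃ : ℕ) : d₁ ∈ gen3 d₁ d₂ d₃ := ⟨1, 0, 0, by ring⟩

lemma mem_gen2_of_mem_gen3 {d₁ d₂ d₃ w : ℕ} (hw : w ∈ gen3 d₁ d₂ d₃)
    (hap : d₁ ≤ w → w - d₁ ∉ gen3 d₁ d₂ d₃) : w ∈ gen2 d₂ d₃ := by
  obtain ⟨a, b, c, rfl⟩ := hw
  rcases a with _ | a
  · exact ⟨b, c, by ring⟩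
  · have hle : d₁ ≤ (a + 1) * d₁ + b * d₂ + c * d₃ := by
      rw [add_one_mul]
      omega
    exact absurd ⟨a, b, c, by rw [add_one_mul]; omega⟩ (hap hle)

lemma finite_compl_gen3 {d₁ d₂ d₃ : ℕ} (h : Nat.gcd d₁ (Nat.gcd d₂ d₃) = 1) :
    (gen3 d₁ d₂ d₃)ᶜ.Finite := by
  obtain ⟨N, hN⟩ := Nat.exists_mem_closure_of_ge ({d₁, d₂, d₃} : Set ℕ)
  refine (Set.finite_lt_nat N).subset fun m hm => ?_
  by_contra hmN
  have hgcd : Nat.setGcd ({d₁, d₂, d₃} : Set ℕ) = 1 := by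
    have hdvd : ∀ x ∈ ({d₁, d₂, d₃} : Set ℕ), Nat.setGcd ({d₁, d₂, d₃} : Set ℕ) ∣ x :=
      fun x hx => Nat.setGcd_dvd_of_mem hx
    rw [← Nat.dvd_one, ← h]
    exact Nat.dvd_gcd (hdvd _ (by simp)) (Nat.dvd_gcd (hdvd _ (by simp)) (hdvd _ (by simp)))
  have hmem := hN m (not_lt.mp hmN) (hgcd ▸ one_dvd m)
  refine hm ?_
  clear hm hmN
  induction hmem using AddSubmonoid.closure_induction with
  | mem x hx =>
    rcases hx with rfl | rfl | rfl
    exacts [⟨1, 0, 0, by ring⟩, ⟨0, 1, 0, by ring⟩, ⟨0, 0, 1, by ring⟩]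
  | zero => exact ⟨0, 0, 0, by ring⟩
  | add x y _ _ hx hy => exact gen3_add_mem hx hy

lemma frobeniusNum_notMem {S : Set ℕ} (hfin : Sᶜ.Finite) (hne : Sᶜ.Nonempty) :
    frobeniusNum S ∉ S :=
  Nat.sSup_mem hne hfin.bddAbove

lemma mem_of_frobeniusNum_lt {S : Set ℕ} (hfin : Sᶜ.Finite) {n : ℕ} (hn : frobeniusNum S < n) :
    n ∈ S := by
  by_contra h
  exact absurd (le_csSup hfin.bddAbove h) (not_le.mpr hn)

lemma conductorNum_eq_frobeniusNum_add_one {S : Set ℕ} (hfin : Sᶜ.Finite) (hne : Sᶜ.Nonempty) :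
    conductorNum S = frobeniusNum S + 1 := by
  have hmem : frobeniusNum S + 1 ∈ {c : ℕ | ∀ n : ℕ, c ≤ n → n ∈ S} :=
    fun n hn => mem_of_frobeniusNum_lt hfin hn
  refine le_antisymm (Nat.sInf_le hmem) ?_
  by_contra! hlt
  exact frobeniusNum_notMem hfin hne (Nat.sInf_mem ⟨_, hmem⟩ _ (Nat.lt_succ_iff.mp hlt))

/-- In a symmetric semigroup the Apéry set with respect to `d₁` consists of the divisors of its
largest element `F + d₁` within `⟨d₂, d₃⟩`. -/
lemma mem_apery_iff_of_symmetric {d₁ d₂ d₃ F : ℕ} (hd₁ : 0 < d₁) (hF : F ∉ gen3 d₁ d₂ d₃)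
    (hlt : ∀ n, F < n → n ∈ gen3 d₁ d₂ d₃)
    (hsym : ∀ n ≤ F, n ∉ gen3 d₁ d₂ d₃ ↔ F - n ∈ gen3 d₁ d₂ d₃) (w : ℕ) :
    (w ∈ gen3 d₁ d₂ d₃ ∧ (d₁ ≤ w → w - d₁ ∉ gen3 d₁ d₂ d₃)) ↔
      w ∈ gen2 d₂ d₃ ∧ ∃ w' ∈ gen2 d₂ d₃, w + w' = F + d₁ := by
  constructor
  · rintro ⟨hw, hap⟩
    refine ⟨mem_gen2_of_mem_gen3 hw hap, F + d₁ - w, ?_, ?_⟩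
    · refine mem_gen2_of_mem_gen3 (d₁ := d₁) ?_ fun hle => ?_
      · rcases lt_or_ge w d₁ with h | h
        · exact hlt _ (by omega)
        · rcases lt_or_ge F (w - d₁) with h' | h'
          · exact absurd (hlt _ h') (hap h)
          · have := (hsym _ h').mp (hap h)
            rwa [show F - (w - d₁) = F + d₁ - w by omega] at this
      · rw [show F + d₁ - w - d₁ = F - w by omega]
        rcases lt_or_ge F w with h | h
        · omega
        · exact fun h' => (hsym w h).mpr h' hw
    · have : w ≤ F + d₁ := by
        by_contra! h
        exact hap (by omega) (hlt _ (by omega))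
      omega
  · rintro ⟨hw, w', hw', hsum⟩
    refine ⟨gen2_subset_gen3 hw, fun hle hmem => hF ?_⟩
    have := gen3_add_mem hmem (gen2_subset_gen3 hw')
    rwa [show w - d₁ + w' = F by omega] at this

/-- A symmetric three-generated semigroup behaves like a complete intersection with relation
degrees `e₁, e₂`: third-order mixed differences over the gaps reduce to corner terms. -/
lemma exists_sum_gaps_mixed_diff {d₁ d₂ d₃ : ℕ} (h : MinGen3 d₁ d₂ d₃)
    (hsym : IsSymmetric (gen3 d₁ d₂ d₃)) {Γ : Finset ℕ} (hΓ : ∀ n, n ∈ Γ ↔ n ∉ gen3 d₁ d₂ d₃) :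
    ∃ e₁ e₂ : ℕ, e₁ + e₂ = frobeniusNum (gen3 d₁ d₂ d₃) + d₁ + d₂ + d₃ ∧
      ∀ f D : ℕ → ℝ, (∀ n, D n = f (n + d₂ + d₃) - f (n + d₂) - f (n + d₃) + f n) →
        ∑ s ∈ Γ, (D (s + d₁) - D s)
          = f 0 - f e₁ - f e₂ + f (e₁ + e₂) - ∑ r ∈ Finset.range d₁, D r := by
  classical
  obtain ⟨h3, h12, h23, -, hgcd, -⟩ := h
  have hfin := finite_compl_gen3 hgcd
  have hone : 1 ∉ gen3 d₁ d₂ d₃ := by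
    rintro ⟨a, b, c, habc⟩
    rcases a with _ | a
    · rcases b with _ | b
      · rcases c with _ | c
        · omega
        · nlinarith [Nat.zero_le (c * d₃)]
      · nlinarith [Nat.zero_le (b * d₂), Nat.zero_le (c * d₃)]
    · nlinarith [Nat.zero_le (a * d₁), Nat.zero_le (b * d₂), Nat.zero_le (c * d₃)]
  have hne : (gen3 d₁ d₂ d₃)ᶜ.Nonempty := ⟨1, hone⟩
  have hF := frobeniusNum_notMem hfin hne
  have hap := mem_apery_iff_of_symmetric (by omega) hF (fun n => mem_of_frobeniusNum_lt hfin) fun n hn => by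
    simpa [conductorNum_eq_frobeniusNum_add_one hfin hne] using
      hsym n (by rw [conductorNum_eq_frobeniusNum_add_one hfin hne]; omega)
  set F := frobeniusNum (gen3 d₁ d₂ d₃)
  have hM : F + d₁ ∈ gen2 d₂ d₃ := by
    obtain ⟨-, w', hw', hsum⟩ := (hap 0).mp ⟨⟨0, 0, 0, by ring⟩, fun hle => by omega⟩
    rw [← hsum, zero_add]
    exact hw'
  obtain ⟨e₁, e₂, he, hsum⟩ := exists_corners_sum_mixed_diff (by omega) (by omega) hM
  refine ⟨e₁, e₂, he, fun f D hD => ?_⟩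
  let A := (Finset.range (F + d₁ + 1)).filter
    fun w => w ∈ gen2 d₂ d₃ ∧ ∃ w' ∈ gen2 d₂ d₃, w + w' = F + d₁
  have hA : ∀ w, w ∈ A ↔ w ∈ gen2 d₂ d₃ ∧ ∃ w' ∈ gen2 d₂ d₃, w + w' = F + d₁ := by
    intro w
    simp only [A, Finset.mem_filter, Finset.mem_range, and_iff_right_iff_imp]
    rintro ⟨-, w', -, hw⟩
    omega
  have htel := sum_apery_add_sum_gaps (d := d₁) (A := A) (Γ := Γ)
    (fun m hm => by
      rw [hΓ] at hm ⊢
      exact fun h' => hm (gen3_add_mem h' (generator_mem_gen3 d₁ d₂ d₃)))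
    (fun m => by rw [hA, ← hap]; simp only [hΓ, not_not]) D
  have hcorner := hsum A hA f
  simp only [← hD] at hcorner
  rw [Finset.sum_sub_distrib]
  linarith

/-- For a symmetric `S₃ = ⟨d₁,d₂,d₃⟩` minimally generated by three positive integers,
`h₂ = K₂/g₃³` satisfies `h₂ = (1/12)·(1 − v)` with `v = π₃/g₃²`;
equivalently `12·K₂ = g₃³ − π₃·g₃`. -/
theorem h2_identity_symmetric (d₁ d₂ d₃ : ℕ) (h : MinGen3 d₁ d₂ d₃)
    (hsym : IsSymmetric (gen3 d₁ d₂ d₃))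
    (σ₁ σ₂ δ₁ δ₂ π₃ g₃ v K₂ h₂ : ℝ)
    (hσ₁ : σ₁ = (d₁ : ℝ) + d₂ + d₃)
    (hσ₂ : σ₂ = (d₁ : ℝ) ^ 2 + (d₂ : ℝ) ^ 2 + (d₃ : ℝ) ^ 2)
    (hδ₁ : δ₁ = (σ₁ - 1) / 2) (hδ₂ : δ₂ = (σ₂ - 1) / 4)
    (hπ₃ : π₃ = (d₁ : ℝ) * d₂ * d₃)
    (hg₃ : g₃ = (frobeniusNum (gen3 d₁ d₂ d₃) : ℝ) + σ₁)
    (hv : v = π₃ / g₃ ^ 2)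
    (hK₂ : K₂ = (gapPowerSum (gen3 d₁ d₂ d₃) 2 : ℝ) +
        σ₁ * (gapPowerSum (gen3 d₁ d₂ d₃) 1 : ℝ) +
        (3 * σ₁ ^ 2 + σ₂) / 12 * (genus (gen3 d₁ d₂ d₃) : ℝ) +
        δ₁ * (δ₁ ^ 2 + δ₂) / 3)
    (hh₂ : h₂ = K₂ / g₃ ^ 3) :
    h₂ = 1 / 12 * (1 - v) ∧ 12 * K₂ = g₃ ^ 3 - π₃ * g₃ := by
  have hfin : (gen3 d₁ d₂ d₃)ᶜ.Finite := finite_compl_gen3 h.2.2.2.2.1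
  obtain ⟨e₁, e₂, he, hsum⟩ := exists_sum_gaps_mixed_diff h hsym (Γ := hfin.toFinset) (by simp)
  have hgap : ∀ r, (gapPowerSum (gen3 d₁ d₂ d₃) r : ℝ) = ∑ s ∈ hfin.toFinset, (s : ℝ) ^ r := by
    intro r
    rw [gapPowerSum, finsum_mem_eq_finite_toFinset_sum _ hfin]
    push_cast
    rfl
  have hgenus : (genus (gen3 d₁ d₂ d₃) : ℝ) = ∑ s ∈ hfin.toFinset, (1 : ℝ) := by
    rw [genus, Set.ncard_eq_toFinset_card _ hfin]
    simp
  have hg : (e₁ : ℝ) + e₂ = g₃ := by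
    rw [hg₃, hσ₁]
    have : ((e₁ + e₂ : ℕ) : ℝ) = _ := congrArg Nat.cast he
    push_cast at this
    linarith
  have hdpos : 0 < d₁ ∧ 0 < d₂ ∧ 0 < d₃ := by
    obtain ⟨h3, h12, h23, -⟩ := h
    omega
  have hd₁ : (0 : ℝ) < d₁ := by exact_mod_cast hdpos.1
  have hd₂ : (0 : ℝ) < d₂ := by exact_mod_cast hdpos.2.1
  have hd₃ : (0 : ℝ) < d₃ := by exact_mod_cast hdpos.2.2
  have hπ : (e₁ : ℝ) * e₂ = π₃ := by
    have h₂ := hsum (fun n => (n : ℝ) ^ 2)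
      (fun n => ((n : ℝ) + d₂ + d₃) ^ 2 - (n + d₂) ^ 2 - (n + d₃) ^ 2 + (n : ℝ) ^ 2)
      (fun n => by push_cast; rfl)
    rw [sum_range_mixed_diff_sq, Finset.sum_eq_zero fun s _ => by push_cast; ring] at h₂
    push_cast at h₂
    rw [hπ₃]
    linarith
  have h₅ := hsum (fun n => (n : ℝ) ^ 5)
    (fun n => ((n : ℝ) + d₂ + d₃) ^ 5 - (n + d₂) ^ 5 - (n + d₃) ^ 5 + (n : ℝ) ^ 5)
    (fun n => by push_cast; rfl)
  have hexpand : ∀ s : ℕ,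
      (((s + d₁ : ℕ) : ℝ) + d₂ + d₃) ^ 5 - ((s + d₁ : ℕ) + d₂) ^ 5 - ((s + d₁ : ℕ) + d₃) ^ 5
        + ((s + d₁ : ℕ) : ℝ) ^ 5
        - (((s : ℝ) + d₂ + d₃) ^ 5 - (s + d₂) ^ 5 - (s + d₃) ^ 5 + (s : ℝ) ^ 5)
      = 60 * π₃ * ((s : ℝ) ^ 2 + σ₁ * (s : ℝ) ^ 1 + (3 * σ₁ ^ 2 + σ₂) / 12 * 1) := by
    intro s
    rw [hπ₃, hσ₁, hσ₂]
    push_cast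
    ring
  rw [sum_range_mixed_diff_pow_five, Finset.sum_congr rfl fun s _ => hexpand s,
    ← Finset.mul_sum, Finset.sum_add_distrib, Finset.sum_add_distrib, ← Finset.mul_sum,
    ← Finset.mul_sum, ← hgap, ← hgap, ← hgenus, ← hπ₃, ← hσ₁, ← hσ₂, ← hδ₁, ← hδ₂] at h₅
  push_cast at h₅
  have hπpos : 0 < π₃ := by rw [hπ₃]; positivity
  have hmain : 12 * K₂ = g₃ ^ 3 - π₃ * g₃ := by
    apply mul_left_cancel₀ (mul_pos (by norm_num : (0 : ℝ) < 5) hπpos).ne'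
    rw [hK₂, ← hg]
    rw [← hπ] at h₅ ⊢
    linear_combination h₅
  refine ⟨?_, hmain⟩
  have hgpos : 0 < g₃ := by rw [hg₃, hσ₁]; positivity
  rw [hh₂, hv]
  field_simp
  linear_combination hmain
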